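/- arXiv:2205.04198 — 2 statements merged into one kernel-verified Lean document; each statement's English description precedes it below -/
import Mathlib

section
/- For two model modifications m1 = (M_c ← K_i → M_i) and m2 = (M_c ← K_j → M_j) with common source M_c, the graph merge_G^min(m1, m2) is a subgraph of merge_G^str(m1, m2) for every valid conflict resolution strategy str, and merge_G^min(m1, m2) equals the intersection (on nodes and on edges) of the graphs merge_G^str(m1, m2) over all valid conflict resolution strategies str; i.e., merge_G^min(m1, m2) is the smallest common subgraph of all graphs produced by the three-way merge under any valid conflict resolution strategy. -/
/-! ## Common framework

Graph elements are drawn from global universes `N` (nodes) and `E` (edges)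
with globally fixed incidence functions `src`, `tgt` (element identity across
graphs; sources and targets are invariant).  A graph is a pair of subsets. -/

/-- A graph given by its sets of node- and edge-identifiers. -/
structure PreGraph (N : Type) (E : Type) where
  verts : Set N
  edges : Set E

/-- `G` is a proper graph w.r.t. the global incidence functions. -/
def IsGraph {N E : Type} (src tgt : E → N) (G : PreGraph N E) : Prop :=
  (∀ e ∈ G.edges, src e ∈ G.verts) ∧ (∀ e ∈ G.edges, tgt e ∈ G.verts)

/-- Membership of an element (node or edge) in a graph. -/
def memEl {N E : Type} (x : N ⊕ E) (G : PreGraph N E) : Prop :=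
  Sum.elim (· ∈ G.verts) (· ∈ G.edges) x

/-- A model modification `(base ← mid → res)`; the two morphisms are partial
identities, i.e. set inclusions (see `Modif.Proper`). -/
structure Modif (N : Type) (E : Type) where
  base : PreGraph N E
  mid : PreGraph N E
  res : PreGraph N E

/-- The span consists of proper graphs and the morphisms are inclusions. -/
def Modif.Proper {N E : Type} (src tgt : E → N) (m : Modif N E) : Prop :=
  IsGraph src tgt m.base ∧ IsGraph src tgt m.mid ∧ IsGraph src tgt m.res ∧
  m.mid.verts ⊆ m.base.verts ∧ m.mid.edges ⊆ m.base.edges ∧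
  m.mid.verts ⊆ m.res.verts ∧ m.mid.edges ⊆ m.res.edges

/-- A modification is maximally preserving iff `K = G ∩ H`. -/
def Modif.MaxPreserving {N E : Type} (m : Modif N E) : Prop :=
  m.mid.verts = m.base.verts ∩ m.res.verts ∧ m.mid.edges = m.base.edges ∩ m.res.edges

def Modif.deletedV {N E : Type} (m : Modif N E) : Set N := m.base.verts \ m.mid.verts
def Modif.createdV {N E : Type} (m : Modif N E) : Set N := m.res.verts \ m.mid.verts
def Modif.deletedE {N E : Type} (m : Modif N E) : Set E := m.base.edges \ m.mid.edges
def Modif.createdE {N E : Type} (m : Modif N E) : Set E := m.res.edges \ m.mid.edges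

/-- `mcheck m1 m2`: all insert-delete conflicts `(e, v)` between two
modifications with common source: one modification creates the edge `e`
whose source or target node `v` is deleted by the other modification. -/
def mcheck {N E : Type} (src tgt : E → N) (m1 m2 : Modif N E) : Set (E × N) :=
  {p | (src p.1 = p.2 ∨ tgt p.1 = p.2) ∧
    ((p.1 ∈ m1.createdE ∧ p.2 ∈ m2.deletedV) ∨
     (p.1 ∈ m2.createdE ∧ p.2 ∈ m1.deletedV))}

/-- Three-way merge equipped with a conflict resolution strategy `str`:
for each insert-delete conflict, `str = true` means the node deletion is
reverted, `str = false` means the edge creation is reverted.  The merged graph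
contains the elements preserved by both modifications and the elements created
by either modification, as altered by the strategy's resolutions. -/
def mergeGr {N E : Type} (src tgt : E → N) (m1 m2 : Modif N E)
    (str : E × N → Bool) : PreGraph N E where
  verts := (m1.mid.verts ∩ m2.mid.verts) ∪ m1.createdV ∪ m2.createdV ∪
    {v | ∃ e, (e, v) ∈ mcheck src tgt m1 m2 ∧ str (e, v) = true}
  edges := (m1.mid.edges ∩ m2.mid.edges) ∪
    {e | e ∈ m1.createdE ∪ m2.createdE ∧
      ∀ v, (e, v) ∈ mcheck src tgt m1 m2 → str (e, v) = true}

/-- A strategy is valid iff it always produces a proper merged graph. -/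
def ValidStrategy {N E : Type} (src tgt : E → N) (m1 m2 : Modif N E)
    (str : E × N → Bool) : Prop :=
  IsGraph src tgt (mergeGr src tgt m1 m2 str)

/-- The deletion-favouring merge `merge_G^min`: preserved elements together
with created elements, excluding every created edge whose source or target
node is deleted by the other modification. -/
def mergeMin {N E : Type} (src tgt : E → N) (m1 m2 : Modif N E) : PreGraph N E :=
  mergeGr src tgt m1 m2 (fun _ => false)

/-! ## Patterns and matches -/

/-- A violation pattern: a graph typed over the type graph `(TN, TE)`. -/
structure Pattern (TN : Type) (TE : Type) where
  NQ : Type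
  EQ : Type
  srcQ : EQ → NQ
  tgtQ : EQ → NQ
  tyV : NQ → TN
  tyE : EQ → TE

/-- A match: a typed graph monomorphism from the pattern `Q` into `X`
(elements of `X` are typed by the global typing `tyN`, `tyEg`). -/
structure IsMatch {N E TN TE : Type} (src tgt : E → N) (tyN : N → TN)
    (tyEg : E → TE) (Q : Pattern TN TE) (X : PreGraph N E)
    (fv : Q.NQ → N) (fe : Q.EQ → E) : Prop where
  inj_v : Function.Injective fv
  inj_e : Function.Injective fe
  comm_src : ∀ e, src (fe e) = fv (Q.srcQ e)
  comm_tgt : ∀ e, tgt (fe e) = fv (Q.tgtQ e)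
  ty_v : ∀ v, tyN (fv v) = Q.tyV v
  ty_e : ∀ e, tyEg (fe e) = Q.tyE e
  mem_v : ∀ v, fv v ∈ X.verts
  mem_e : ∀ e, fe e ∈ X.edges

/-- `pcheck X φ`: the set of all matches of the violation pattern into `X`. -/
def pcheck {N E TN TE : Type} (src tgt : E → N) (tyN : N → TN) (tyEg : E → TE)
    (Q : Pattern TN TE) (X : PreGraph N E) : Set ((Q.NQ → N) × (Q.EQ → E)) :=
  {m | IsMatch src tgt tyN tyEg Q X m.1 m.2}

/-! ## Correct model versionings -/

/-- A correct model versioning: models `M i`, modification relation `delta`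
(each modification is the maximally preserving one, with partial-identity
morphisms, between its endpoints — it is determined by the two endpoints),
an acyclic predecessor relation, and an initial model `root`. -/
structure Versioning (N : Type) (E : Type) (src tgt : E → N) (ι : Type) where
  M : ι → PreGraph N E
  isGraph : ∀ i, IsGraph src tgt (M i)
  delta : ι → ι → Prop
  acyclic : ∀ i, ¬ Relation.TransGen delta i i
  root : ι
  root_pre : ∀ i, i ≠ root → Relation.TransGen delta root i

namespace Versioning

variable {N E ι : Type} {src tgt : E → N}

/-- `pre a b`: `a` is a predecessor of `b`. -/
def pre (V : Versioning N E src tgt ι) (a b : ι) : Prop :=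
  Relation.TransGen V.delta a b

/-- The union `P^M` of all model versions. -/
def unionPG (V : Versioning N E src tgt ι) : PreGraph N E :=
  ⟨⋃ i, (V.M i).verts, ⋃ i, (V.M i).edges⟩

/-- `cv` edges of the multi-version model: element `x` has a `cv` edge to
version `j` iff some modification into `M j` creates `x`, or `j` is the
initial version and `x ∈ M root`. -/
def cvR (V : Versioning N E src tgt ι) (x : N ⊕ E) (j : ι) : Prop :=
  (∃ i, V.delta i j ∧ ¬ memEl x (V.M i) ∧ memEl x (V.M j)) ∨
  (j = V.root ∧ memEl x (V.M V.root))

/-- `dv` edges: element `x` has a `dv` edge to version `j` iff some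
modification into `M j` deletes `x`. -/
def dvR (V : Versioning N E src tgt ι) (x : N ⊕ E) (j : ι) : Prop :=
  ∃ i, V.delta i j ∧ memEl x (V.M i) ∧ ¬ memEl x (V.M j)

/-- mv-presence: `x` is mv-present in version `i` iff there is a version `j`
with a `cv` edge from `x` and a path of `suc` edges from `j` to `i` that does
not pass through any version with a `dv` edge from `x`. -/
def mvPresent (V : Versioning N E src tgt ι) (x : N ⊕ E) (i : ι) : Prop :=
  ∃ j, V.cvR x j ∧ ¬ V.dvR x j ∧
    Relation.ReflTransGen (fun a b => V.delta a b ∧ ¬ V.dvR x b) j i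

/-- `p x`: the set of versions in which `x` is mv-present. -/
def pSet (V : Versioning N E src tgt ι) (x : N ⊕ E) : Set ι :=
  {i | V.mvPresent x i}

/-- The projection `proj(MVM, i)`. -/
def projPG (V : Versioning N E src tgt ι) (i : ι) : PreGraph N E :=
  ⟨{v | V.mvPresent (Sum.inl v) i}, {e | V.mvPresent (Sum.inr e) i}⟩

/-- `proj^Δ(MVM, c, i)`: the maximally preserving model modification from
`proj(MVM, c)` to `proj(MVM, i)`. -/
def projModif (V : Versioning N E src tgt ι) (c i : ι) : Modif N E :=
  ⟨V.projPG c,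
   ⟨(V.projPG c).verts ∩ (V.projPG i).verts,
    (V.projPG c).edges ∩ (V.projPG i).edges⟩,
   V.projPG i⟩

/-- `pre^C i j`: the set of latest common predecessors (empty if one of the
two versions is a predecessor of the other). -/
def preC (V : Versioning N E src tgt ι) (i j : ι) : Set ι :=
  {c | ¬ V.pre i j ∧ ¬ V.pre j i ∧ V.pre c i ∧ V.pre c j ∧
       ∀ x, V.pre x i → V.pre x j → ¬ V.pre c x}

end Versioning

/-! ## The multi-version model as a typed graph -/

/-- A typed graph (over the node-type universe `TN` and edge-type universe
`TE` of its type graph). -/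
structure TypedGraph (TN : Type) (TE : Type) where
  V : Type
  Ed : Type
  Vset : Set V
  Eset : Set Ed
  s : Ed → V
  t : Ed → V
  tyV : V → TN
  tyE : Ed → TE

/-- Node types of the adapted type graph `TM_mv`: a node `corr_mv x` for each
node and each edge `x` of `TM`, plus the node `version`. -/
abbrev TNmv (TN TE : Type) : Type := (TN ⊕ TE) ⊕ Unit

/-- Edge types of `TM_mv`: `corr^s`, `corr^t`, `suc`, `cv`, `dv`. -/
abbrev TEmv (TN TE : Type) : Type :=
  (TE ⊕ TE) ⊕ (Unit ⊕ ((TN ⊕ TE) ⊕ (TN ⊕ TE)))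

/-- Nodes of the multi-version model: one node per element of `P^M`
(the `origin` bijection is the identity on `N ⊕ E`) and one node per version. -/
abbrev MVNode (N E ι : Type) : Type := (N ⊕ E) ⊕ ι

/-- Edges of the multi-version model: source- and target-encoding edges,
`suc` edges, `cv` edges and `dv` edges. -/
abbrev MVEdge (N E ι : Type) : Type :=
  (E ⊕ E) ⊕ ((ι × ι) ⊕ (((N ⊕ E) × ι) ⊕ ((N ⊕ E) × ι)))

/-- A typed graph monomorphism. -/
def IsTypedMono {TN TE : Type} (A B : TypedGraph TN TE)
    (fv : A.V → B.V) (fe : A.Ed → B.Ed) : Prop :=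
  Function.Injective fv ∧ Function.Injective fe ∧
  (∀ v ∈ A.Vset, fv v ∈ B.Vset) ∧ (∀ e ∈ A.Eset, fe e ∈ B.Eset) ∧
  (∀ e, B.s (fe e) = fv (A.s e)) ∧ (∀ e, B.t (fe e) = fv (A.t e)) ∧
  (∀ v, B.tyV (fv v) = A.tyV v) ∧ (∀ e, B.tyE (fe e) = A.tyE e)

/-- `trans_mv Q`: the translation of a pattern `Q` (typed over `TM`) to a
typed graph over `TM_mv`; `origin_Q` is the identity. -/
def Pattern.transMV {TN TE : Type} (Q : Pattern TN TE) :
    TypedGraph (TNmv TN TE) (TEmv TN TE) where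
  V := Q.NQ ⊕ Q.EQ
  Ed := Q.EQ ⊕ Q.EQ
  Vset := Set.univ
  Eset := Set.univ
  s := Sum.elim (fun e => Sum.inr e) (fun e => Sum.inr e)
  t := Sum.elim (fun e => Sum.inl (Q.srcQ e)) (fun e => Sum.inl (Q.tgtQ e))
  tyV := Sum.elim (fun v => Sum.inl (Sum.inl (Q.tyV v)))
    (fun e => Sum.inl (Sum.inr (Q.tyE e)))
  tyE := Sum.elim (fun e => Sum.inl (Sum.inl (Q.tyE e)))
    (fun e => Sum.inl (Sum.inr (Q.tyE e)))

/-- `comb Δ`: the multi-version model of a correct model versioning, as a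
typed graph over the adapted type graph (global element typing `tyN`, `tyEg`). -/
def Versioning.comb {N E ι TN TE : Type} {src tgt : E → N}
    (V : Versioning N E src tgt ι) (tyN : N → TN) (tyEg : E → TE) :
    TypedGraph (TNmv TN TE) (TEmv TN TE) where
  V := MVNode N E ι
  Ed := MVEdge N E ι
  Vset := {w | match w with
    | Sum.inl (Sum.inl v) => v ∈ V.unionPG.verts
    | Sum.inl (Sum.inr e) => e ∈ V.unionPG.edges
    | Sum.inr _ => True}
  Eset := {w | match w with
    | Sum.inl (Sum.inl e) => e ∈ V.unionPG.edges
    | Sum.inl (Sum.inr e) => e ∈ V.unionPG.edges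
    | Sum.inr (Sum.inl (i, j)) => V.delta i j
    | Sum.inr (Sum.inr (Sum.inl (x, j))) => V.cvR x j
    | Sum.inr (Sum.inr (Sum.inr (x, j))) => V.dvR x j}
  s := fun w => match w with
    | Sum.inl (Sum.inl e) => Sum.inl (Sum.inr e)
    | Sum.inl (Sum.inr e) => Sum.inl (Sum.inr e)
    | Sum.inr (Sum.inl (i, _)) => Sum.inr i
    | Sum.inr (Sum.inr (Sum.inl (x, _))) => Sum.inl x
    | Sum.inr (Sum.inr (Sum.inr (x, _))) => Sum.inl x
  t := fun w => match w with
    | Sum.inl (Sum.inl e) => Sum.inl (Sum.inl (src e))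
    | Sum.inl (Sum.inr e) => Sum.inl (Sum.inl (tgt e))
    | Sum.inr (Sum.inl (_, j)) => Sum.inr j
    | Sum.inr (Sum.inr (Sum.inl (_, j))) => Sum.inr j
    | Sum.inr (Sum.inr (Sum.inr (_, j))) => Sum.inr j
  tyV := fun w => match w with
    | Sum.inl (Sum.inl v) => Sum.inl (Sum.inl (tyN v))
    | Sum.inl (Sum.inr e) => Sum.inl (Sum.inr (tyEg e))
    | Sum.inr _ => Sum.inr ()
  tyE := fun w => match w with
    | Sum.inl (Sum.inl e) => Sum.inl (Sum.inl (tyEg e))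
    | Sum.inl (Sum.inr e) => Sum.inl (Sum.inr (tyEg e))
    | Sum.inr (Sum.inl _) => Sum.inr (Sum.inl ())
    | Sum.inr (Sum.inr (Sum.inl (x, _))) =>
        Sum.inr (Sum.inr (Sum.inl (Sum.elim (fun v => Sum.inl (tyN v))
          (fun e => Sum.inr (tyEg e)) x)))
    | Sum.inr (Sum.inr (Sum.inr (x, _))) =>
        Sum.inr (Sum.inr (Sum.inr (Sum.elim (fun v => Sum.inl (tyN v))
          (fun e => Sum.inr (tyEg e)) x)))

/-- `Corr Q fv m` states `m = origin ∘ m_mv ∘ origin_Q⁻¹` for the node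
function `fv` of a morphism `m_mv : trans_mv Q → MVM`. -/
def Corr {N E TN TE ι : Type} (Q : Pattern TN TE)
    (fv : (Q.NQ ⊕ Q.EQ) → MVNode N E ι)
    (m : (Q.NQ → N) × (Q.EQ → E)) : Prop :=
  (∀ v, fv (Sum.inl v) = Sum.inl (Sum.inl (m.1 v))) ∧
  (∀ e, fv (Sum.inr e) = Sum.inl (Sum.inr (m.2 e)))

/-- mv-presence set of a node of the multi-version model (element-representing
nodes only; version nodes get `∅`). -/
def Versioning.pOf {N E ι : Type} {src tgt : E → N}
    (V : Versioning N E src tgt ι) (w : MVNode N E ι) : Set ι :=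
  match w with
  | Sum.inl x => V.pSet x
  | Sum.inr _ => ∅

/-- `pcheck_mv(MVM, φ)`: all matches `m_mv` of `trans_mv Q` into `MVM` are
found; for each, `P = ⋂_{v} p (m_mv v)` is computed and, if `P ≠ ∅`, the
corresponding match `m = origin ∘ m_mv ∘ origin_Q⁻¹` is reported as a
violation in every version of `P`. -/
def pcheckMV {N E TN TE ι : Type} (src tgt : E → N) (tyN : N → TN)
    (tyEg : E → TE) (V : Versioning N E src tgt ι) (Q : Pattern TN TE) :
    Set (ι × ((Q.NQ → N) × (Q.EQ → E))) :=
  {p | ∃ (fv : (Q.NQ ⊕ Q.EQ) → MVNode N E ι) (fe : (Q.EQ ⊕ Q.EQ) → MVEdge N E ι),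
    IsTypedMono Q.transMV (V.comb tyN tyEg) fv fe ∧
    Corr Q fv p.2 ∧
    ∀ v : Q.NQ ⊕ Q.EQ, p.1 ∈ V.pOf (fv v)}

/-- `mcheck_mv(MVM)`: all insert-delete conflicts of all possible merges,
computed on the multi-version model and reported in normalized form. -/
def mcheckMV {N E ι : Type} [LinearOrder ι] (src tgt : E → N)
    (V : Versioning N E src tgt ι) : Set (ι × ι × ι × (E × N)) :=
  {q | ∃ e v i j c, q = (min i j, max i j, c, (e, v)) ∧
    (v = src e ∨ v = tgt e) ∧
    (∃ j', V.cvR (Sum.inr e) j' ∧ j' ≠ V.root) ∧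
    V.pSet (Sum.inr e) ≠ V.pSet (Sum.inl v) ∧
    i ∈ V.pSet (Sum.inr e) ∧
    (∃ k, V.dvR (Sum.inl v) k ∧ ¬ V.cvR (Sum.inl v) k ∧
      Relation.ReflTransGen (fun a b => V.delta a b ∧ ¬ V.cvR (Sum.inl v) b) k j) ∧
    c ∈ V.preC i j ∧ c ∈ V.pSet (Sum.inl v) ∧ c ∉ V.pSet (Sum.inr e)}

/-- `pcheck^m_mv(MVM, φ)`: for each match `m_mv` of `trans_mv Q` into `MVM`
with corresponding match `m`, each pair of versions `i`, `j` such that every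
node in the image of `m_mv` is mv-present in `i` or in `j`, and each latest
common predecessor `c ∈ pre^C(i, j)` such that every element matched by `m`
that lies in `M c` lies in both `M i` and `M j`, the normalized tuple
`(min i j, max i j, c, m)` is reported. -/
def pcheckMergeMV {N E TN TE ι : Type} [LinearOrder ι] (src tgt : E → N)
    (tyN : N → TN) (tyEg : E → TE) (V : Versioning N E src tgt ι)
    (Q : Pattern TN TE) :
    Set (ι × ι × ι × ((Q.NQ → N) × (Q.EQ → E))) :=
  {q | ∃ i j c m, q = (min i j, max i j, c, m) ∧
    ∃ (fv : (Q.NQ ⊕ Q.EQ) → MVNode N E ι) (fe : (Q.EQ ⊕ Q.EQ) → MVEdge N E ι),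
      IsTypedMono Q.transMV (V.comb tyN tyEg) fv fe ∧
      Corr Q fv m ∧
      (∀ v : Q.NQ ⊕ Q.EQ, i ∈ V.pOf (fv v) ∨ j ∈ V.pOf (fv v)) ∧
      c ∈ V.preC i j ∧
      (∀ v : Q.NQ, m.1 v ∈ (V.M c).verts →
        m.1 v ∈ (V.M i).verts ∧ m.1 v ∈ (V.M j).verts) ∧
      (∀ e : Q.EQ, m.2 e ∈ (V.M c).edges →
        m.2 e ∈ (V.M i).edges ∧ m.2 e ∈ (V.M j).edges)}

/-- A node of `m.res` not deleted by `m'` is preserved by both modifications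
or created by `m`. -/
theorem mem_mid_inter_or_createdV {N E : Type} {m m' : Modif N E} {v : N}
    (hbase : m.base.verts ⊆ m'.base.verts) (hmid : m.mid.verts ⊆ m.base.verts)
    (hres : v ∈ m.res.verts) (hdel : v ∉ m'.deletedV) :
    v ∈ m.mid.verts ∩ m'.mid.verts ∨ v ∈ m.createdV := by
  by_cases hv : v ∈ m.mid.verts
  · left
    refine ⟨hv, ?_⟩
    by_contra hv'
    exact hdel ⟨hbase (hmid hv), hv'⟩
  · exact Or.inr ⟨hres, hv⟩

/-- The deletion-favouring merge is contained in every merge. -/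
theorem mergeMin_subset_mergeGr {N E : Type} (src tgt : E → N) (m1 m2 : Modif N E)
    (str : E × N → Bool) :
    (mergeMin src tgt m1 m2).verts ⊆ (mergeGr src tgt m1 m2 str).verts ∧
      (mergeMin src tgt m1 m2).edges ⊆ (mergeGr src tgt m1 m2 str).edges := by
  constructor
  · rintro v (hv | ⟨e, -, he⟩)
    · exact Or.inl hv
    · simp at he
  · rintro e (he | ⟨he, hc⟩)
    · exact Or.inl he
    · exact Or.inr ⟨he, fun v hv => absurd (hc v hv) (by simp)⟩

/-- Always reverting the edge creation is a valid strategy. -/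
theorem validStrategy_false {N E : Type} (src tgt : E → N) (m1 m2 : Modif N E)
    (h1 : m1.Proper src tgt) (h2 : m2.Proper src tgt) (hcommon : m1.base = m2.base) :
    ValidStrategy src tgt m1 m2 (fun _ => false) := by
  obtain ⟨-, ⟨hs1, ht1⟩, ⟨hrs1, hrt1⟩, hv1, -⟩ := h1
  obtain ⟨-, ⟨hs2, ht2⟩, ⟨hrs2, hrt2⟩, hv2, -⟩ := h2
  have hb : m1.base.verts = m2.base.verts := by rw [hcommon]
  have endpoint : ∀ e v, (src e = v ∨ tgt e = v) →
      (e ∈ m1.mid.edges ∩ m2.mid.edges → v ∈ m1.mid.verts ∩ m2.mid.verts) →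
      (e ∈ m1.res.edges → v ∈ m1.res.verts) →
      (e ∈ m2.res.edges → v ∈ m2.res.verts) →
      e ∈ (mergeGr src tgt m1 m2 (fun _ => false)).edges →
      v ∈ (mergeGr src tgt m1 m2 (fun _ => false)).verts := by
    rintro e v hev hmid hr1 hr2 (he | ⟨he | he, hc⟩)
    · exact Or.inl (Or.inl (Or.inl (hmid he)))
    · rcases mem_mid_inter_or_createdV hb.subset hv1 (hr1 he.1)
        (fun hd => Bool.false_ne_true (hc v ⟨hev, Or.inl ⟨he, hd⟩⟩)) with h | h
      · exact Or.inl (Or.inl (Or.inl h))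
      · exact Or.inl (Or.inl (Or.inr h))
    · rcases mem_mid_inter_or_createdV hb.symm.subset hv2 (hr2 he.1)
        (fun hd => Bool.false_ne_true (hc v ⟨hev, Or.inr ⟨he, hd⟩⟩)) with h | h
      · exact Or.inl (Or.inl (Or.inl h.symm))
      · exact Or.inl (Or.inr h)
  exact ⟨fun e he => endpoint e _ (Or.inl rfl) (fun h => ⟨hs1 e h.1, hs2 e h.2⟩)
      (hrs1 e) (hrs2 e) he,
    fun e he => endpoint e _ (Or.inr rfl) (fun h => ⟨ht1 e h.1, ht2 e h.2⟩)
      (hrt1 e) (hrt2 e) he⟩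

/-- `merge_G^min (m1, m2)` is a subgraph of
`merge_G^str (m1, m2)` for every valid conflict resolution strategy `str`, and
it equals the intersection (on nodes and on edges) of the merged graphs over
all valid strategies: it is the smallest common subgraph of all graphs
produced by the three-way merge under any valid strategy. -/
theorem mergeMin_smallest_common_subgraph
    {N E : Type} (src tgt : E → N) (m1 m2 : Modif N E)
    (h1 : m1.Proper src tgt) (h2 : m2.Proper src tgt)
    (hcommon : m1.base = m2.base) :
    (∀ str : E × N → Bool, ValidStrategy src tgt m1 m2 str →
      (mergeMin src tgt m1 m2).verts ⊆ (mergeGr src tgt m1 m2 str).verts ∧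
      (mergeMin src tgt m1 m2).edges ⊆ (mergeGr src tgt m1 m2 str).edges) ∧
    (mergeMin src tgt m1 m2).verts =
      ⋂ (str : E × N → Bool) (_ : ValidStrategy src tgt m1 m2 str),
        (mergeGr src tgt m1 m2 str).verts ∧
    (mergeMin src tgt m1 m2).edges =
      ⋂ (str : E × N → Bool) (_ : ValidStrategy src tgt m1 m2 str),
        (mergeGr src tgt m1 m2 str).edges := by
  have hvalid := validStrategy_false src tgt m1 m2 h1 h2 hcommon
  refine ⟨fun str _ => mergeMin_subset_mergeGr src tgt m1 m2 str, ?_, ?_⟩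
  · exact Set.Subset.antisymm
      (Set.subset_iInter₂ fun str _ => (mergeMin_subset_mergeGr src tgt m1 m2 str).1)
      (Set.iInter₂_subset _ hvalid)
  · exact Set.Subset.antisymm
      (Set.subset_iInter₂ fun str _ => (mergeMin_subset_mergeGr src tgt m1 m2 str).2)
      (Set.iInter₂_subset _ hvalid)
end

section
/- For a correct model versioning Δ over models M_1, …, M_n with multi-version model MVM = comb(Δ), mv-presence exactly captures element containment: for every element x of the union P^M = ⋃_i M_i and every version M_i, it holds that x ∈ M_i if and only if M_i ∈ p(origin^{-1}(x)), i.e., iff the node of MVM representing x is mv-present in M_i. -/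
namespace Versioning

variable {N E ι : Type} {src tgt : E → N}

theorem memEl_of_cvR (V : Versioning N E src tgt ι) {x : N ⊕ E} {j : ι} (h : V.cvR x j) :
    memEl x (V.M j) := by
  rcases h with ⟨_, _, _, h⟩ | ⟨rfl, h⟩ <;> exact h

theorem not_dvR_of_memEl (V : Versioning N E src tgt ι) {x : N ⊕ E} {j : ι}
    (h : memEl x (V.M j)) : ¬ V.dvR x j :=
  fun ⟨_, _, _, hn⟩ => hn h

theorem mvPresent_of_cvR (V : Versioning N E src tgt ι) {x : N ⊕ E} {j : ι} (h : V.cvR x j) :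
    V.mvPresent x j :=
  ⟨j, h, V.not_dvR_of_memEl (V.memEl_of_cvR h), .refl⟩

theorem reflTransGen_root (V : Versioning N E src tgt ι) (i : ι) :
    Relation.ReflTransGen V.delta V.root i := by
  by_cases h : i = V.root
  · exact h ▸ .refl
  · exact (V.root_pre i h).to_reflTransGen

theorem mvPresent_of_memEl (V : Versioning N E src tgt ι) {x : N ⊕ E} {i : ι}
    (hx : memEl x (V.M i)) : V.mvPresent x i := by
  induction V.reflTransGen_root i with
  | refl => exact V.mvPresent_of_cvR (.inr ⟨rfl, hx⟩)
  | @tail b c _ hbc ih =>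
    by_cases hb : memEl x (V.M b)
    · obtain ⟨j, hcv, hdv, hpath⟩ := ih hb
      exact ⟨j, hcv, hdv, hpath.tail ⟨hbc, V.not_dvR_of_memEl hx⟩⟩
    · exact V.mvPresent_of_cvR (.inl ⟨b, hbc, hb, hx⟩)

theorem memEl_of_mvPresent (V : Versioning N E src tgt ι) {x : N ⊕ E} {i : ι}
    (h : V.mvPresent x i) : memEl x (V.M i) := by
  obtain ⟨j, hcv, _, hpath⟩ := h
  induction hpath with
  | refl => exact V.memEl_of_cvR hcv
  | tail _ hbc ih =>
    by_contra hc
    exact hbc.2 ⟨_, hbc.1, ih, hc⟩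

end Versioning

/-- mv-presence exactly captures element containment: for
every element `x` of the union `P^M = ⋃_i M_i` and every version `i`,
`x ∈ M_i` iff the node of `MVM` representing `x` is mv-present in `M_i`,
i.e. iff `i ∈ p (origin⁻¹ x)`. -/
theorem mvPresent_iff_mem
    {N E ι : Type} (src tgt : E → N) (V : Versioning N E src tgt ι) :
    ∀ x : N ⊕ E, (∃ k, memEl x (V.M k)) →
      ∀ i : ι, memEl x (V.M i) ↔ V.mvPresent x i :=
  fun _ _ _ => ⟨V.mvPresent_of_memEl, V.memEl_of_mvPresent⟩
end
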